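/- The measures μ_k converge weakly to b^p times Lebesgue measure on [0,1): for every interval I ⊆ [0,1), lim_{k→∞} μ_k(I) = b^p |I|. -/

import Mathlib

open scoped BigOperators ENNReal
open MeasureTheory

/-- Number of (possibly overlapping) occurrences of the block `w` in `X`. -/
def occCount {α : Type*} [DecidableEq α] (w X : List α) : ℕ :=
  ((List.range X.length).filter fun i => (X.drop i).take w.length = w).length

/-- The base-`b` value of a digit string (most significant digit first). -/
def listVal (b : ℕ) (X : List (Fin b)) : ℕ :=
  X.foldl (fun a d => b * a + d.val) 0

/-- The discrete measure `μ_k = Σ_X b^{-|X|} δ_{n(X)/b^{|X|}}`, summed over all strings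
`X` over `{0,…,b-1}` with exactly `k` occurrences of `w`. -/
noncomputable def mu (b : ℕ) (w : List (Fin b)) (k : ℕ) : Measure ℝ :=
  Measure.sum fun X : {X : List (Fin b) // occCount w X = k} =>
    (((b : ℝ≥0∞) ^ X.1.length)⁻¹) •
      Measure.dirac ((listVal b X.1 : ℝ) / (b : ℝ) ^ X.1.length)

/-- `S_w(k) = Σ 1/m` over positive integers `m` whose minimal base-`b` representation
contains exactly `k` occurrences of `w`. -/
noncomputable def Sw (b : ℕ) (w : List (Fin b)) (k : ℕ) : ℝ :=
  ∑' m : ℕ,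
    if m ≠ 0 ∧ occCount (w.map Fin.val) (Nat.digits b m).reverse = k then (m : ℝ)⁻¹ else 0

section Strings

variable {b : ℕ} {w : List (Fin b)}

theorem occCount_nil : occCount w [] = 0 := by
  simp [occCount]

theorem occCount_cons (d : Fin b) (X : List (Fin b)) :
    occCount w (d :: X) = occCount w X + if w <+: d :: X then 1 else 0 := by
  have h : w <+: d :: X ↔ (d :: X).take w.length = w := by
    rw [List.prefix_iff_eq_take, eq_comm]
  simp only [occCount, List.length_cons, List.range_succ_eq_map, List.filter_cons, List.filter_map,
    List.drop_zero, h, decide_eq_true_eq]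
  split_ifs <;> simp [Function.comp_def]

theorem occCount_le_length (X : List (Fin b)) : occCount w X ≤ X.length :=
  (List.length_filter_le _ _).trans_eq List.length_range

theorem one_le_occCount_append (hw : w ≠ []) (Z : List (Fin b)) : 1 ≤ occCount w (w ++ Z) := by
  obtain ⟨d, v, rfl⟩ := List.exists_cons_of_ne_nil hw
  rw [List.cons_append, occCount_cons, if_pos (by simp)]
  omega

/-- Occurrences inside `Y ++ w` that start within `Y` are not affected by what follows. -/
theorem exists_occCount_append_append (Y : List (Fin b)) :
    ∃ c ≤ Y.length, ∀ Z, occCount w (Y ++ w ++ Z) = c + occCount w (w ++ Z) := by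
  induction Y with
  | nil => exact ⟨0, le_rfl, fun Z => by simp⟩
  | cons d Y ih =>
    obtain ⟨c, hc, h⟩ := ih
    refine ⟨c + if w <+: d :: (Y ++ w) then 1 else 0, ?_, fun Z => ?_⟩
    · rw [List.length_cons]
      split_ifs <;> omega
    · have hp : w <+: d :: (Y ++ w ++ Z) ↔ w <+: d :: (Y ++ w) := by
        rw [← List.cons_append]
        refine ⟨fun hp => ?_, fun hp => hp.trans (List.prefix_append _ _)⟩
        exact List.prefix_of_prefix_length_le hp (List.prefix_append _ _) (by simp; omega)
      rw [List.cons_append, List.cons_append, occCount_cons, h]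
      simp only [hp]
      omega

theorem listVal_foldl (X : List (Fin b)) (a : ℕ) :
    X.foldl (fun a d => b * a + d.val) a = a * b ^ X.length + listVal b X := by
  induction X generalizing a with
  | nil => simp [listVal]
  | cons d X ih =>
    simp only [listVal, List.foldl_cons, List.length_cons]
    rw [ih, ih (b * 0 + _)]
    ring

theorem listVal_append (Y Z : List (Fin b)) :
    listVal b (Y ++ Z) = listVal b Y * b ^ Z.length + listVal b Z := by
  rw [listVal, List.foldl_append, listVal_foldl]
  rfl

theorem listVal_singleton (d : Fin b) : listVal b [d] = d := by
  simp [listVal]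

theorem listVal_lt (X : List (Fin b)) : listVal b X < b ^ X.length := by
  induction X using List.reverseRecOn with
  | nil => simp [listVal]
  | append_singleton X d ih =>
    rw [listVal_append, listVal_singleton, List.length_append, List.length_singleton, pow_one,
      pow_succ]
    have := d.isLt
    nlinarith

theorem exists_listVal_eq (m : ℕ) : ∀ j < b ^ m, ∃ Y : List (Fin b), Y.length = m ∧
    listVal b Y = j := by
  induction m with
  | zero => exact fun j hj => ⟨[], rfl, by simp at hj; simp [listVal, hj]⟩
  | succ m ih =>
    intro j hj
    have hb : 0 < b := by
      by_contra h
      simp_all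
    obtain ⟨Y, hY, hYj⟩ := ih (j / b) (Nat.div_lt_of_lt_mul (by rwa [← pow_succ']))
    refine ⟨Y ++ [⟨j % b, Nat.mod_lt _ hb⟩], by simp [hY], ?_⟩
    rw [listVal_append, listVal_singleton, hYj]
    simpa using Nat.div_add_mod' j b

theorem eq_of_listVal_eq {Y Y' : List (Fin b)} (hl : Y.length = Y'.length)
    (h : listVal b Y = listVal b Y') : Y = Y' := by
  induction Y using List.reverseRecOn generalizing Y' with
  | nil => exact (List.length_eq_zero_iff.1 hl.symm).symm
  | append_singleton Y d ih =>
    rcases List.eq_nil_or_concat Y' with rfl | ⟨Y', d', rfl⟩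
    · simp at hl
    simp only [List.concat_eq_append, listVal_append, listVal_singleton, List.length_singleton,
      pow_one] at h hl ⊢
    have hd := d.isLt
    have hd' := d'.isLt
    have hb : 0 < b := by omega
    have h1 : listVal b Y = listVal b Y' := by
      have := congrArg (· / b) h
      simpa [Nat.add_div_of_dvd_right, Nat.mul_add_div, mul_comm _ b, Nat.div_eq_of_lt, hd, hd', hb]
        using this
    have h2 : d = d' := Fin.ext (by rw [h1] at h; omega)
    rw [ih (by simpa using hl) h1, h2]

end Strings

section WordAverage

variable {b : ℕ}

/-- The average of `f` over the words of length `n`. -/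
noncomputable def wordAvg : ℕ → (List (Fin b) → ℝ) → ℝ
  | 0, f => f []
  | n + 1, f => (b : ℝ)⁻¹ * ∑ d, wordAvg n fun Z => f (d :: Z)

theorem wordAvg_append (m n : ℕ) (f : List (Fin b) → ℝ) :
    wordAvg (m + n) f = wordAvg m fun Y => wordAvg n fun Z => f (Y ++ Z) := by
  induction m generalizing f with
  | zero => simp [wordAvg]
  | succ m ih => simp [Nat.succ_add, wordAvg, ih]

theorem wordAvg_mono {n : ℕ} {f g : List (Fin b) → ℝ} (h : ∀ Z, Z.length = n → f Z ≤ g Z) :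
    wordAvg n f ≤ wordAvg n g := by
  induction n generalizing f g with
  | zero => exact h [] rfl
  | succ n ih =>
    refine mul_le_mul_of_nonneg_left (Finset.sum_le_sum fun d _ => ih fun Z hZ => h _ ?_)
      (by positivity)
    simp [hZ]

theorem wordAvg_congr {n : ℕ} {f g : List (Fin b) → ℝ} (h : ∀ Z, Z.length = n → f Z = g Z) :
    wordAvg n f = wordAvg n g :=
  le_antisymm (wordAvg_mono fun Z hZ => (h Z hZ).le) (wordAvg_mono fun Z hZ => (h Z hZ).ge)

theorem wordAvg_const (hb : b ≠ 0) (n : ℕ) (c : ℝ) :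
    wordAvg n (fun _ : List (Fin b) => c) = c := by
  induction n with
  | zero => rfl
  | succ n ih => simp [wordAvg, ih, hb]

theorem wordAvg_zero (n : ℕ) : wordAvg n (fun _ : List (Fin b) => 0) = 0 := by
  induction n with
  | zero => rfl
  | succ n ih => simp [wordAvg, ih]

theorem wordAvg_eq_zero {n : ℕ} {f : List (Fin b) → ℝ} (h : ∀ Z, Z.length = n → f Z = 0) :
    wordAvg n f = 0 :=
  (wordAvg_congr h).trans (wordAvg_zero n)

theorem wordAvg_nonneg {n : ℕ} {f : List (Fin b) → ℝ} (h : ∀ Z, 0 ≤ f Z) : 0 ≤ wordAvg n f :=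
  (wordAvg_zero n).ge.trans (wordAvg_mono fun Z _ => h Z)

theorem wordAvg_add (n : ℕ) (f g : List (Fin b) → ℝ) :
    wordAvg n (fun Z => f Z + g Z) = wordAvg n f + wordAvg n g := by
  induction n generalizing f g with
  | zero => rfl
  | succ n ih => simp only [wordAvg, ih, Finset.sum_add_distrib, mul_add]

theorem wordAvg_const_mul (n : ℕ) (c : ℝ) (f : List (Fin b) → ℝ) :
    wordAvg n (fun Z => c * f Z) = c * wordAvg n f := by
  induction n generalizing f with
  | zero => rfl
  | succ n ih => simp only [wordAvg, ih, ← Finset.mul_sum]; ring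

theorem wordAvg_finset_sum {ι : Type*} (s : Finset ι) (n : ℕ) (f : ι → List (Fin b) → ℝ) :
    wordAvg n (fun Z => ∑ i ∈ s, f i Z) = ∑ i ∈ s, wordAvg n (f i) := by
  induction n generalizing f with
  | zero => rfl
  | succ n ih => simp only [wordAvg, ih, ← Finset.mul_sum, Finset.sum_comm (s := s)]

theorem hasSum_wordAvg {ι : Type*} {n : ℕ} {f : ι → List (Fin b) → ℝ} {g : List (Fin b) → ℝ}
    (h : ∀ Z, HasSum (fun i => f i Z) (g Z)) :
    HasSum (fun i => wordAvg n (f i)) (wordAvg n g) := by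
  induction n generalizing f g with
  | zero => exact h []
  | succ n ih => exact (hasSum_sum fun d _ => ih fun Z => h (d :: Z)).mul_left _

theorem wordAvg_ite_eq (w : List (Fin b)) (c : ℝ) :
    wordAvg w.length (fun Z => if Z = w then c else 0) = ((b : ℝ) ^ w.length)⁻¹ * c := by
  induction w with
  | nil => simp [wordAvg]
  | cons d w ih =>
    rw [List.length_cons, wordAvg, Finset.sum_eq_single d]
    · simp only [List.cons.injEq, true_and, ih]
      rw [pow_succ, mul_inv]
      ring
    · intro e _ he
      simp [he, wordAvg_zero]
    · simp

/-- Summing over all words amounts to summing the averages over each length. -/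
theorem tsum_words_eq_tsum_wordAvg (hb : b ≠ 0) {f : List (Fin b) → ℝ} (hf : ∀ Z, 0 ≤ f Z) :
    ∑' Z, ((b : ℝ≥0∞) ^ Z.length)⁻¹ * ENNReal.ofReal (f Z) =
      ∑' n, ENNReal.ofReal (wordAvg n f) := by
  rw [← List.equivSigmaTuple.symm.tsum_eq, ENNReal.tsum_sigma']
  refine tsum_congr fun n => ?_
  simp only [List.equivSigmaTuple, Equiv.coe_fn_symm_mk, List.length_ofFn, tsum_fintype]
  induction n generalizing f with
  | zero => simp [wordAvg]
  | succ n ih =>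
    rw [wordAvg, ENNReal.ofReal_mul (by positivity),
      ENNReal.ofReal_sum_of_nonneg fun d _ => wordAvg_nonneg fun Z => hf _,
      ENNReal.ofReal_inv_of_pos (by positivity), ENNReal.ofReal_natCast,
      ← (Fin.consEquiv fun _ => Fin b).sum_comp, Fintype.sum_prod_type, Finset.mul_sum]
    refine Finset.sum_congr rfl fun d _ => ?_
    rw [← ih fun Z => hf _, Finset.mul_sum]
    refine Finset.sum_congr rfl fun v _ => ?_
    rw [← mul_assoc, pow_succ', ENNReal.mul_inv (by simp [hb]) (by simp)]
    simp [Fin.consEquiv]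

end WordAverage

section Occurrences

open Filter Topology

variable {b : ℕ} {w : List (Fin b)}

/-- The probability that `w` occurs exactly `k` times in `Y` followed by `n` random digits. -/
noncomputable def occProb (w Y : List (Fin b)) (k n : ℕ) : ℝ :=
  wordAvg n fun Z => if occCount w (Y ++ Z) = k then 1 else 0

theorem occProb_nonneg (Y : List (Fin b)) (k n : ℕ) : 0 ≤ occProb w Y k n :=
  wordAvg_nonneg fun Z => by split_ifs <;> norm_num

theorem occProb_le_one (hb : b ≠ 0) (Y : List (Fin b)) (k n : ℕ) : occProb w Y k n ≤ 1 :=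
  (wordAvg_mono fun Z _ => by split_ifs <;> norm_num).trans_eq (wordAvg_const hb n 1)

theorem occProb_eq_zero {Y : List (Fin b)} {k n : ℕ} (h : Y.length + n < k) :
    occProb w Y k n = 0 := by
  refine wordAvg_eq_zero fun Z hZ => if_neg ?_
  have := occCount_le_length (w := w) (Y ++ Z)
  rw [List.length_append] at this
  omega

theorem occProb_add (Y : List (Fin b)) (k m n : ℕ) :
    occProb w Y k (m + n) = wordAvg m fun Z => occProb w (Y ++ Z) k n := by
  simp only [occProb, wordAvg_append, List.append_assoc]

theorem wordAvg_prefix_add (hb : b ≠ 0) (k n : ℕ) :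
    wordAvg (n + 1) (fun X => if w <+: X ∧ occCount w X = k + 1 then 1 else 0) +
      wordAvg (n + 1) (fun X => if occCount w X ≤ k then 1 else 0) =
    wordAvg n (fun X => if occCount w X ≤ k then 1 else 0) := by
  rw [← wordAvg_add, wordAvg]
  have h (d : Fin b) (Z : List (Fin b)) :
      ((if w <+: d :: Z ∧ occCount w (d :: Z) = k + 1 then (1 : ℝ) else 0) +
        if occCount w (d :: Z) ≤ k then 1 else 0) = if occCount w Z ≤ k then 1 else 0 := by
    rw [occCount_cons]
    by_cases hp : w <+: d :: Z
    · simp only [hp, true_and, if_true, add_left_inj]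
      split_ifs <;> first | omega | norm_num
    · simp [hp]
  simp [h, hb]

theorem sum_wordAvg_prefix (hb : b ≠ 0) (hw : w ≠ []) (k N : ℕ) :
    ∑ n ∈ Finset.range (N + 1),
        wordAvg n (fun X => if w <+: X ∧ occCount w X = k + 1 then (1 : ℝ) else 0) =
      1 - wordAvg N (fun X => if occCount w X ≤ k then 1 else 0) := by
  induction N with
  | zero => simp [wordAvg, hw, occCount_nil]
  | succ N ih =>
    rw [Finset.sum_range_succ, ih, ← wordAvg_prefix_add hb k N]
    ring

theorem wordAvg_prefix_length_add (k n : ℕ) :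
    wordAvg (w.length + n) (fun X => if w <+: X ∧ occCount w X = k then (1 : ℝ) else 0) =
      ((b : ℝ) ^ w.length)⁻¹ * occProb w w k n := by
  rw [wordAvg_append, ← wordAvg_ite_eq]
  refine wordAvg_congr fun Y hY => ?_
  split_ifs with h
  · simp [h, occProb]
  · refine wordAvg_eq_zero fun Z _ => if_neg fun hp => h ?_
    exact ((List.prefix_of_prefix_length_le hp.1 (List.prefix_append _ _) hY.ge).eq_of_length
      hY.symm).symm

theorem sum_occProb_self (hb : b ≠ 0) (hw : w ≠ []) (k N : ℕ) :
    ∑ n ∈ Finset.range N, occProb w w (k + 1) n = (b : ℝ) ^ w.length *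
      (1 - wordAvg (w.length - 1 + N) (fun X => if occCount w X ≤ k then 1 else 0)) := by
  have hp : 0 < w.length := List.length_pos_of_ne_nil hw
  rw [← sum_wordAvg_prefix hb hw, show w.length - 1 + N + 1 = w.length + N by omega,
    Finset.sum_range_add, Finset.sum_eq_zero (s := Finset.range w.length),
    zero_add]
  · simp only [wordAvg_prefix_length_add, ← Finset.mul_sum]
    rw [mul_inv_cancel_left₀ (by positivity)]
  · intro n hn
    rw [Finset.mem_range] at hn
    refine wordAvg_eq_zero fun X hX => if_neg fun h => ?_
    have := h.1.length_le
    omega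

theorem sum_occProb_self_le (hb : b ≠ 0) (hw : w ≠ []) (k N : ℕ) :
    ∑ n ∈ Finset.range N, occProb w w k n ≤ (b : ℝ) ^ w.length := by
  cases k with
  | zero =>
    rw [Finset.sum_eq_zero]
    · positivity
    · intro n _
      exact wordAvg_eq_zero fun Z _ =>
        if_neg (Nat.one_le_iff_ne_zero.1 (one_le_occCount_append hw Z))
  | succ k =>
    rw [sum_occProb_self hb hw]
    refine mul_le_of_le_one_right (by positivity) (sub_le_self _ (wordAvg_nonneg fun X => ?_))
    split_ifs <;> norm_num

theorem sum_occProb_append_self_le (hb : b ≠ 0) (hw : w ≠ []) (Y : List (Fin b)) (k N : ℕ) :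
    ∑ n ∈ Finset.range N, occProb w (Y ++ w) k n ≤ (b : ℝ) ^ w.length := by
  obtain ⟨c, -, hc⟩ := exists_occCount_append_append (w := w) Y
  obtain h | ⟨l, rfl⟩ := (lt_or_ge k c).imp_right Nat.exists_eq_add_of_le
  · rw [Finset.sum_eq_zero]
    · positivity
    · intro n _
      refine wordAvg_eq_zero fun Z _ => if_neg ?_
      rw [hc]
      omega
  · simpa only [occProb, hc, Nat.add_left_cancel_iff] using sum_occProb_self_le hb hw l N

theorem sum_occProb_le (hb : b ≠ 0) (hw : w ≠ []) (Y : List (Fin b)) (k N : ℕ) :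
    ∑ n ∈ Finset.range N, occProb w Y k n ≤ (b : ℝ) ^ w.length * (w.length + 1) := by
  have hp : 0 < w.length := List.length_pos_of_ne_nil hw
  have hB : 0 < (b : ℝ) ^ w.length := by positivity
  set C : ℝ := (b : ℝ) ^ w.length * (w.length + 1) with hC
  induction N generalizing Y with
  | zero => simp only [Finset.range_zero, Finset.sum_empty]; positivity
  | succ N ih =>
    calc ∑ n ∈ Finset.range (N + 1), occProb w Y k n
        ≤ ∑ n ∈ Finset.range (w.length + N), occProb w Y k n :=
          Finset.sum_le_sum_of_subset_of_nonneg (Finset.range_mono (by omega))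
            fun n _ _ => occProb_nonneg Y k n
      _ = ∑ n ∈ Finset.range w.length, occProb w Y k n +
            wordAvg w.length fun Z => ∑ n ∈ Finset.range N, occProb w (Y ++ Z) k n := by
          simp only [Finset.sum_range_add, occProb_add, wordAvg_finset_sum]
      _ ≤ ∑ n ∈ Finset.range w.length, 1 +
            wordAvg w.length fun Z => C + if Z = w then (b : ℝ) ^ w.length - C else 0 := by
          refine add_le_add (Finset.sum_le_sum fun n _ => occProb_le_one hb Y k n)
            (wordAvg_mono fun Z _ => ?_)
          split_ifs with h
          · rw [h, add_sub_cancel]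
            exact sum_occProb_append_self_le hb hw Y k N
          · rw [add_zero]
            exact ih (Y ++ Z)
      _ = C := by
          rw [wordAvg_add, wordAvg_const hb, wordAvg_ite_eq, hC]
          simp
          field_simp
          ring

theorem summable_occProb (hb : b ≠ 0) (hw : w ≠ []) (Y : List (Fin b)) (k : ℕ) :
    Summable (occProb w Y k) :=
  summable_of_sum_range_le (occProb_nonneg Y k) (sum_occProb_le hb hw Y k)

theorem tendsto_wordAvg_occCount_le (hb : b ≠ 0) (hw : w ≠ []) (k : ℕ) :
    Tendsto (fun n => wordAvg n fun X => if occCount w X ≤ k then (1 : ℝ) else 0) atTop (𝓝 0) := by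
  have h (n : ℕ) : (wordAvg n fun X => if occCount w X ≤ k then (1 : ℝ) else 0) =
      ∑ j ∈ Finset.range (k + 1), occProb w [] j n := by
    simp only [occProb, ← wordAvg_finset_sum, List.nil_append, Finset.sum_ite_eq, Finset.mem_range,
      Nat.lt_succ_iff]
  simp only [h]
  rw [← Finset.sum_const_zero (s := Finset.range (k + 1))]
  exact tendsto_finsetSum _ fun j _ => (summable_occProb hb hw [] j).tendsto_atTop_zero

theorem tsum_occProb_self (hb : b ≠ 0) (hw : w ≠ []) {k : ℕ} (hk : k ≠ 0) :
    ∑' n, occProb w w k n = (b : ℝ) ^ w.length := by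
  obtain ⟨k, rfl⟩ := Nat.exists_eq_succ_of_ne_zero hk
  refine tendsto_nhds_unique (summable_occProb hb hw w _).hasSum.tendsto_sum_nat ?_
  simp only [Nat.succ_eq_add_one, sum_occProb_self hb hw]
  simpa using (((tendsto_wordAvg_occCount_le hb hw k).comp
    (tendsto_add_atTop_nat (w.length - 1))).const_sub 1).const_mul ((b : ℝ) ^ w.length) |>.congr
    fun n => by simp [add_comm]

theorem tsum_occProb_append_self (hb : b ≠ 0) (hw : w ≠ []) {Y : List (Fin b)} {k : ℕ}
    (hk : Y.length < k) : ∑' n, occProb w (Y ++ w) k n = (b : ℝ) ^ w.length := by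
  obtain ⟨c, hcY, hc⟩ := exists_occCount_append_append (w := w) Y
  obtain ⟨l, rfl⟩ := Nat.exists_eq_add_of_le (hcY.trans hk.le)
  rw [← tsum_occProb_self hb hw (k := l) (by omega)]
  simp only [occProb, hc, Nat.add_left_cancel_iff]

theorem tsum_occProb_eq_wordAvg (hb : b ≠ 0) (hw : w ≠ []) {Y : List (Fin b)} {k m : ℕ}
    (hk : Y.length + m < k) :
    ∑' n, occProb w Y k n = wordAvg m fun Z => ∑' n, occProb w (Y ++ Z) k n := by
  rw [← (summable_occProb hb hw Y k).sum_add_tsum_nat_add m, Finset.sum_eq_zero, zero_add]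
  · simp only [add_comm _ m, occProb_add]
    exact (hasSum_wordAvg fun Z => (summable_occProb hb hw (Y ++ Z) k).hasSum).tsum_eq
  · intro n hn
    rw [Finset.mem_range] at hn
    exact occProb_eq_zero (by omega)

theorem abs_tsum_occProb_sub_le (hb : b ≠ 0) (hw : w ≠ []) (m : ℕ) {Y : List (Fin b)} {k : ℕ}
    (hk : Y.length + m * w.length < k) :
    |∑' n, occProb w Y k n - (b : ℝ) ^ w.length| ≤
      (b : ℝ) ^ w.length * (w.length + 1) * (1 - ((b : ℝ) ^ w.length)⁻¹) ^ m := by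
  have hB : 0 < (b : ℝ) ^ w.length := by positivity
  induction m generalizing Y with
  | zero =>
    have h0 : 0 ≤ ∑' n, occProb w Y k n := tsum_nonneg (occProb_nonneg Y k)
    have h1 := Real.tsum_le_of_sum_range_le (occProb_nonneg Y k) (sum_occProb_le hb hw Y k)
    have h2 : 0 ≤ (b : ℝ) ^ w.length * w.length := by positivity
    rw [pow_zero, mul_one, abs_le]
    constructor <;> linarith
  | succ m ih =>
    set B : ℝ := (b : ℝ) ^ w.length
    set K : ℝ := B * (w.length + 1) * (1 - B⁻¹) ^ m with hK
    have hstep (Z : List (Fin b)) (hZ : Z.length = w.length) :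
        |∑' n, occProb w (Y ++ Z) k n - B| ≤ K + if Z = w then -K else 0 := by
      split_ifs with h
      · rw [h, tsum_occProb_append_self hb hw (by omega)]
        simp [B]
      · rw [add_zero]
        refine ih ?_
        rw [List.length_append, hZ]
        linarith
    have hK' : B * (w.length + 1) * (1 - B⁻¹) ^ (m + 1) =
        wordAvg w.length fun Z => K + if Z = w then -K else 0 := by
      rw [wordAvg_add, wordAvg_const hb, wordAvg_ite_eq, pow_succ, ← mul_assoc, ← hK]
      ring
    have hlt : Y.length + w.length < k := by
      rw [Nat.succ_mul] at hk
      omega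
    have hsub : ∑' n, occProb w Y k n - B =
        wordAvg w.length fun Z => ∑' n, occProb w (Y ++ Z) k n + -B := by
      rw [wordAvg_add, wordAvg_const hb, ← tsum_occProb_eq_wordAvg hb hw hlt, sub_eq_add_neg]
    rw [hK', hsub, abs_le, neg_eq_neg_one_mul, ← wordAvg_const_mul]
    constructor
    · refine wordAvg_mono fun Z hZ => ?_
      have := (abs_le.1 (hstep Z hZ)).1
      linarith
    · refine wordAvg_mono fun Z hZ => ?_
      have := (abs_le.1 (hstep Z hZ)).2
      linarith

theorem tendsto_tsum_occProb (hb : b ≠ 0) (hw : w ≠ []) (Y : List (Fin b)) :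
    Tendsto (fun k => ∑' n, occProb w Y k n) atTop (𝓝 ((b : ℝ) ^ w.length)) := by
  have hb1 : (1 : ℝ) ≤ b := by exact_mod_cast Nat.one_le_iff_ne_zero.2 hb
  have hlim : Tendsto (fun m : ℕ => (b : ℝ) ^ w.length * (w.length + 1) *
      (1 - ((b : ℝ) ^ w.length)⁻¹) ^ m) atTop (𝓝 0) := by
    rw [← mul_zero ((b : ℝ) ^ w.length * (w.length + 1))]
    refine (tendsto_pow_atTop_nhds_zero_of_lt_one ?_ ?_).const_mul _
    · exact sub_nonneg.2 (inv_le_one_of_one_le₀ (one_le_pow₀ hb1))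
    · exact sub_lt_self _ (by positivity)
  rw [Metric.tendsto_atTop]
  intro ε hε
  obtain ⟨m, hm⟩ := (hlim.eventually_lt_const hε).exists
  refine ⟨Y.length + m * w.length + 1, fun k hk => ?_⟩
  exact (abs_tsum_occProb_sub_le hb hw m hk).trans_lt hm

end Occurrences

section Cells

open Filter Topology Set

variable {b : ℕ} {w : List (Fin b)}

theorem listVal_div_mem_Ico_iff (hb : b ≠ 0) {X Y : List (Fin b)} (h : Y.length ≤ X.length) :
    (listVal b X : ℝ) / (b : ℝ) ^ X.length ∈
      Ico ((listVal b Y : ℝ) / b ^ Y.length) ((listVal b Y + 1 : ℝ) / b ^ Y.length) ↔ Y <+: X := by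
  obtain ⟨Y', Z, rfl, hY'⟩ : ∃ Y' Z, X = Y' ++ Z ∧ Y'.length = Y.length :=
    ⟨X.take Y.length, X.drop Y.length, (List.take_append_drop _ _).symm, by simpa using h⟩
  have hpre : Y <+: Y' ++ Z ↔ Y = Y' :=
    ⟨fun hp => (List.prefix_of_prefix_length_le hp (List.prefix_append _ _) hY'.ge).eq_of_length
      hY'.symm, fun hp => hp ▸ List.prefix_append _ _⟩
  have hval : Y = Y' ↔ listVal b Y' = listVal b Y :=
    ⟨fun hp => hp ▸ rfl, fun hp => eq_of_listVal_eq hY'.symm hp.symm⟩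
  have hZ := listVal_lt Z
  have hm : (0 : ℝ) < b ^ Y.length := by positivity
  have hB : (0 : ℝ) < b ^ Z.length := by positivity
  rw [hpre, hval, listVal_append, List.length_append, hY', pow_add, mem_Ico,
    div_le_div_iff₀ hm (by positivity), div_lt_div_iff₀ (by positivity) hm,
    mul_comm ((b : ℝ) ^ Y.length), ← mul_assoc, ← mul_assoc, mul_le_mul_iff_left₀ hm,
    mul_lt_mul_iff_left₀ hm]
  norm_cast
  constructor
  · rintro ⟨h1, h2⟩
    have h3 : listVal b Y < listVal b Y' + 1 := by
      by_contra! hc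
      have := Nat.mul_le_mul_right (b ^ Z.length) hc
      nlinarith
    have h4 : listVal b Y' < listVal b Y + 1 := by
      by_contra! hc
      have := Nat.mul_le_mul_right (b ^ Z.length) hc
      nlinarith
    omega
  · intro h
    rw [h]
    constructor <;> nlinarith

theorem tsum_words_occCount (hb : b ≠ 0) (hw : w ≠ []) (Y : List (Fin b)) (k : ℕ) :
    ∑' Z, ((b : ℝ≥0∞) ^ Z.length)⁻¹ *
        ENNReal.ofReal (if occCount w (Y ++ Z) = k then 1 else 0) =
      ENNReal.ofReal (∑' n, occProb w Y k n) := by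
  rw [tsum_words_eq_tsum_wordAvg hb fun Z => by split_ifs <;> norm_num]
  exact (ENNReal.ofReal_tsum_of_nonneg (occProb_nonneg Y k) (summable_occProb hb hw Y k)).symm

theorem mu_apply (k : ℕ) {S : Set ℝ} (hS : MeasurableSet S) :
    mu b w k S = ∑' X : List (Fin b), ((b : ℝ≥0∞) ^ X.length)⁻¹ *
      {X | occCount w X = k ∧ (listVal b X : ℝ) / (b : ℝ) ^ X.length ∈ S}.indicator 1 X := by
  rw [mu, Measure.sum_apply _ hS]
  simp only [Measure.smul_apply, smul_eq_mul, Measure.dirac_apply' _ hS]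
  refine (tsum_subtype {X : List (Fin b) | occCount w X = k} fun X =>
    ((b : ℝ≥0∞) ^ X.length)⁻¹ *
      S.indicator 1 ((listVal b X : ℝ) / (b : ℝ) ^ X.length)).trans (tsum_congr fun X => ?_)
  by_cases h1 : occCount w X = k <;>
    by_cases h2 : (listVal b X : ℝ) / (b : ℝ) ^ X.length ∈ S <;> simp [h1, h2]

theorem mu_cell (hb : b ≠ 0) (hw : w ≠ []) {Y : List (Fin b)} {k : ℕ} (hk : Y.length < k) :
    mu b w k (Ico ((listVal b Y : ℝ) / b ^ Y.length) ((listVal b Y + 1 : ℝ) / b ^ Y.length)) =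
      ENNReal.ofReal (((b : ℝ) ^ Y.length)⁻¹ * ∑' n, occProb w Y k n) := by
  rw [mu_apply k measurableSet_Ico, ENNReal.ofReal_mul (by positivity),
    ← tsum_words_occCount hb hw, ← ENNReal.tsum_mul_left,
    ← (List.append_right_injective Y).tsum_eq]
  · refine tsum_congr fun Z => ?_
    have hmem := (listVal_div_mem_Ico_iff hb (X := Y ++ Z) (Y := Y) (by simp)).2
      (List.prefix_append _ _)
    rw [ENNReal.ofReal_inv_of_pos (by positivity), ENNReal.ofReal_pow (by positivity),
      ENNReal.ofReal_natCast, ← mul_assoc, List.length_append, pow_add,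
      ENNReal.mul_inv (by simp [hb]) (by simp)]
    congr 1
    by_cases h : occCount w (Y ++ Z) = k
    · rw [indicator_of_mem (mem_ofPred.2 ⟨h, hmem⟩), if_pos h]
      simp
    · simp [h]
  · intro X hX
    have hX' : X ∈ {X | occCount w X = k ∧ (listVal b X : ℝ) / (b : ℝ) ^ X.length ∈
        Ico ((listVal b Y : ℝ) / b ^ Y.length) ((listVal b Y + 1 : ℝ) / b ^ Y.length)} := by
      by_contra h
      exact hX (by simp only [indicator_of_notMem h, mul_zero])
    have hle := occCount_le_length (w := w) X
    rw [hX'.1] at hle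
    obtain ⟨Z, hZ⟩ := (listVal_div_mem_Ico_iff hb (hk.le.trans hle)).1 hX'.2
    exact ⟨Z, hZ⟩

theorem tendsto_mu_cell (hb : b ≠ 0) (hw : w ≠ []) {m j : ℕ} (hj : j < b ^ m) :
    Tendsto (fun k => mu b w k (Ico ((j : ℝ) / b ^ m) ((j + 1 : ℝ) / b ^ m))) atTop
      (𝓝 (ENNReal.ofReal ((b : ℝ) ^ w.length * (1 / b ^ m)))) := by
  obtain ⟨Y, rfl, rfl⟩ := exists_listVal_eq m j hj
  rw [one_div, mul_comm]
  refine (ENNReal.tendsto_ofReal ((tendsto_tsum_occProb hb hw Y).const_mul _)).congr' ?_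
  filter_upwards [eventually_gt_atTop Y.length] with k hk using (mu_cell hb hw hk).symm

theorem tendsto_mu_Ico (hb : b ≠ 0) (hw : w ≠ []) (m i : ℕ) {j : ℕ} (hj : j ≤ b ^ m) :
    Tendsto (fun k => mu b w k (Ico ((i : ℝ) / b ^ m) ((j : ℝ) / b ^ m))) atTop
      (𝓝 (ENNReal.ofReal ((b : ℝ) ^ w.length * ((j - i) / b ^ m)))) := by
  have hm : (0 : ℝ) < b ^ m := by positivity
  obtain h | h := le_total j i
  · have h' : (j : ℝ) ≤ i := by exact_mod_cast h
    rw [Ico_eq_empty (not_lt.2 (by gcongr)), ENNReal.ofReal_of_nonpos]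
    · simp
    · exact mul_nonpos_of_nonneg_of_nonpos (by positivity)
        (div_nonpos_of_nonpos_of_nonneg (by linarith) hm.le)
  · induction j, h using Nat.le_induction with
    | base => simp
    | succ j hij ih =>
      have hij' : (i : ℝ) ≤ j := by exact_mod_cast hij
      have hsplit (k : ℕ) : mu b w k (Ico ((i : ℝ) / b ^ m) (((j + 1 : ℕ) : ℝ) / b ^ m)) =
          mu b w k (Ico ((i : ℝ) / b ^ m) ((j : ℝ) / b ^ m)) +
            mu b w k (Ico ((j : ℝ) / b ^ m) ((j + 1 : ℝ) / b ^ m)) := by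
        rw [← measure_union (Ico_disjoint_Ico_same) measurableSet_Ico,
          Ico_union_Ico_eq_Ico (by gcongr) (by gcongr; linarith)]
        push_cast
        rfl
      simp only [hsplit]
      convert (ih (by omega)).add (tendsto_mu_cell hb hw (m := m) (j := j) (by omega)) using 2
      rw [← ENNReal.ofReal_add]
      · push_cast
        congr 1
        ring
      · exact mul_nonneg (by positivity) (div_nonneg (by linarith) hm.le)
      · positivity

end Cells

open Filter in
/-- The measures `μ_k` converge weakly to `b^p` times Lebesgue measure on `[0,1)`:
for every interval `I ⊆ [0,1)`, `μ_k(I) → b^p |I|` where `|I| = sup I - inf I`. -/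
theorem stmt18 (b : ℕ) (hb : 1 < b) (w : List (Fin b)) (hw : 1 ≤ w.length)
    (I : Set ℝ) (hI : I ⊆ Set.Ico 0 1) (hI' : I.OrdConnected) :
    Tendsto (fun k => mu b w k I) atTop
      (nhds (ENNReal.ofReal ((b : ℝ) ^ w.length * (sSup I - sInf I)))) := by
  have hb0 : b ≠ 0 := by omega
  have hw0 : w ≠ [] := List.ne_nil_of_length_pos hw
  obtain rfl | hne := I.eq_empty_or_nonempty
  · simp
  have hbelow : BddBelow I := ⟨0, fun x hx => (hI hx).1⟩
  have habove : BddAbove I := ⟨1, fun x hx => (hI hx).2.le⟩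
  have h0 : 0 ≤ sInf I := le_csInf hne fun x hx => (hI hx).1
  have h1 : sSup I ≤ 1 := csSup_le hne fun x hx => (hI hx).2.le
  have hle : sInf I ≤ sSup I := csInf_le_csSup hne hbelow habove
  set a := sInf I
  set c := sSup I
  have hinner : Set.Ioo a c ⊆ I := fun x hx => by
    obtain ⟨y, hy, hyx⟩ := exists_lt_of_csInf_lt hne hx.1
    obtain ⟨z, hz, hxz⟩ := exists_lt_of_lt_csSup hne hx.2
    exact hI'.out hy hz ⟨hyx.le, hxz.le⟩
  have herr (s : ℝ) : Tendsto (fun m : ℕ =>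
      ENNReal.ofReal ((b : ℝ) ^ w.length * (c - a + s * ((b : ℝ)⁻¹) ^ m))) atTop
      (nhds (ENNReal.ofReal ((b : ℝ) ^ w.length * (c - a)))) := by
    refine ENNReal.tendsto_ofReal (Tendsto.const_mul _ ?_)
    have := tendsto_pow_atTop_nhds_zero_of_lt_one (r := (b : ℝ)⁻¹) (by positivity)
      (inv_lt_one_of_one_lt₀ (by exact_mod_cast hb))
    simpa using (this.const_mul s).const_add (c - a)
  refine tendsto_of_le_liminf_of_limsup_le (le_of_tendsto' (herr (-2)) fun m => ?_)
    (ge_of_tendsto' (herr 2) fun m => ?_)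
  all_goals
    have hm : (0 : ℝ) < (b : ℝ) ^ m := by positivity
    have hinv : ((b : ℝ)⁻¹) ^ m * b ^ m = 1 := by
      rw [← mul_pow, inv_mul_cancel₀ (by positivity), one_pow]
    have ha := Nat.floor_le (mul_nonneg h0 hm.le)
    have ha' := Nat.lt_floor_add_one (a * (b : ℝ) ^ m)
    have hc := Nat.floor_le (mul_nonneg (h0.trans hle) hm.le)
    have hc' := Nat.lt_floor_add_one (c * (b : ℝ) ^ m)
  · have hj : ⌊c * (b : ℝ) ^ m⌋₊ ≤ b ^ m := by
      refine Nat.floor_le_of_le ?_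
      push_cast
      exact mul_le_of_le_one_left hm.le h1
    have hlim := tendsto_mu_Ico hb0 hw0 m (⌊a * (b : ℝ) ^ m⌋₊ + 1) hj
    refine le_trans (ENNReal.ofReal_le_ofReal ?_) (hlim.liminf_eq.ge.trans
      (liminf_le_liminf (Eventually.of_forall fun k => measure_mono fun x hx => hinner ⟨?_, ?_⟩)))
    · refine mul_le_mul_of_nonneg_left ?_ (by positivity)
      rw [le_div_iff₀ hm]
      push_cast
      linear_combination ha + hc' - 2 * hinv
    · refine lt_of_lt_of_le ?_ hx.1
      rw [lt_div_iff₀ hm]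
      exact_mod_cast ha'
    · refine hx.2.trans_le ?_
      rwa [div_le_iff₀ hm]
  · have hlim := tendsto_mu_Ico hb0 hw0 m ⌊a * (b : ℝ) ^ m⌋₊
      (min_le_right (⌊c * (b : ℝ) ^ m⌋₊ + 1) (b ^ m))
    refine le_trans (limsup_le_limsup (Eventually.of_forall fun k =>
      measure_mono fun x hx => Set.mem_Ico.2 ⟨?_, ?_⟩))
      (hlim.limsup_eq.le.trans (ENNReal.ofReal_le_ofReal ?_))
    · refine le_trans ?_ (csInf_le hbelow hx)
      rwa [div_le_iff₀ hm]
    · rw [lt_div_iff₀ hm, Nat.cast_min, lt_min_iff]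
      push_cast
      refine ⟨lt_of_le_of_lt ?_ hc', mul_lt_of_lt_one_left hm (hI hx).2⟩
      exact mul_le_mul_of_nonneg_right (le_csSup habove hx) hm.le
    · refine mul_le_mul_of_nonneg_left ?_ (by positivity)
      have hmin : ((min (⌊c * (b : ℝ) ^ m⌋₊ + 1) (b ^ m) : ℕ) : ℝ) ≤ ⌊c * (b : ℝ) ^ m⌋₊ + 1 := by
        exact_mod_cast min_le_left _ _
      rw [div_le_iff₀ hm]
      linear_combination hmin + hc + ha' - 2 * hinv
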